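/- Let (m_n) be a sequence of real numbers and define the forward difference (Δm)_n = m_{n+1} − m_n. Then (m_n) is completely monotonic, i.e. (−1)^k (Δ^k m)_n ≥ 0 for all n, k ∈ ℕ, if and only if there exists a (unique) finite Borel measure μ on [0,1] with m_n = ∫₀¹ x^n dμ(x) for all n ∈ ℕ. -/

import Mathlib

open MeasureTheory

/-- Forward difference operator on real sequences. -/
def fwdDiffSeq (f : ℕ → ℝ) : ℕ → ℝ := fun n => f (n + 1) - f n

namespace HausdorffAux

open Polynomial

lemma step (m : ℕ → ℝ) (k n : ℕ) :
    (fwdDiffSeq^[k+1] m) n = (fwdDiffSeq^[k] m) (n+1) - (fwdDiffSeq^[k] m) n := by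
  rw [Function.iterate_succ_apply']; rfl

/-- The moment functional on polynomials. -/
noncomputable def L (m : ℕ → ℝ) : ℝ[X] →ₗ[ℝ] ℝ :=
  Polynomial.lsum (fun i => LinearMap.mulRight ℝ (m i))

lemma L_X (m : ℕ → ℝ) (n : ℕ) : L m (X ^ n) = m n := by
  rw [← Polynomial.monomial_one_right_eq_X_pow]
  simp [L, Polynomial.lsum_apply, Polynomial.sum_monomial_index]

lemma L_XX (m : ℕ → ℝ) (k n : ℕ) :
    L m (X ^ n * (1 - X) ^ k) = (-1 : ℝ) ^ k * (fwdDiffSeq^[k] m) n := by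
  induction k generalizing n with
  | zero => simp [L_X]
  | succ k ih =>
    have : (X ^ n * (1 - X) ^ (k+1) : ℝ[X]) = X ^ n * (1 - X) ^ k - X ^ (n+1) * (1 - X) ^ k := by
      ring
    rw [this, map_sub, ih, ih, step]; ring

lemma choose_desc (n M j : ℕ) :
    (n + M).choose (n + j) * (n + j).descFactorial n = (n + M).descFactorial n * M.choose j := by
  rw [Nat.descFactorial_eq_factorial_mul_choose, Nat.descFactorial_eq_factorial_mul_choose]
  by_cases h : j ≤ M
  · have := Nat.choose_mul (n := n + M) (k := n + j) (s := n) (by omega)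
    simp only [Nat.add_sub_cancel_left] at this
    calc _ = n.factorial * ((n + M).choose (n + j) * (n + j).choose n) := by ring
      _ = _ := by rw [this]; ring
  · rw [Nat.choose_eq_zero_of_lt (by omega : n + M < n + j),
      Nat.choose_eq_zero_of_lt (by omega : M < j)]; simp

lemma bern (n M : ℕ) :
    ∑ k ∈ Finset.range (n + M + 1), (((n+M).choose k * k.descFactorial n : ℕ) : ℝ) •
      (X ^ k * (1 - X) ^ (n + M - k) : ℝ[X]) = ((n+M).descFactorial n : ℝ) • X ^ n := by
  rw [add_assoc, Finset.sum_range_add, Finset.sum_eq_zero, zero_add]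
  · have h1 : (∑ x ∈ Finset.range (M+1), (X:ℝ[X]) ^ x * (1 - X) ^ (M - x) * (M.choose x : ℝ[X])) = 1 := by
      rw [← add_pow]; simp
    have h2 : ((n+M).descFactorial n : ℝ) • (X ^ n : ℝ[X]) = ((n+M).descFactorial n : ℝ) • (X ^ n * 
      (∑ x ∈ Finset.range (M+1), (X:ℝ[X]) ^ x * (1 - X) ^ (M - x) * (M.choose x : ℝ[X]))) := by
      rw [h1, mul_one]
    rw [h2, Finset.mul_sum, Finset.smul_sum]
    refine Finset.sum_congr rfl fun j _ => ?_
    rw [choose_desc, show n + M - (n + j) = M - j by omega]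
    simp only [Polynomial.smul_eq_C_mul]
    push_cast
    simp only [map_mul, map_natCast]
    ring
  · intro k hk
    rw [Nat.descFactorial_of_lt (Finset.mem_range.1 hk)]; simp

/-- Bernstein weights. -/
noncomputable def w (m : ℕ → ℝ) (N k : ℕ) : ℝ :=
  (N.choose k : ℝ) * ((-1 : ℝ) ^ (N-k) * (fwdDiffSeq^[N-k] m) k)

lemma sum_w (m : ℕ → ℝ) (n N : ℕ) (h : n ≤ N) :
    ∑ k ∈ Finset.range (N + 1), w m N k * ((k.descFactorial n : ℝ) / (N.descFactorial n : ℝ)) = m n := by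
  obtain ⟨M, rfl⟩ := Nat.exists_eq_add_of_le h
  have h0 : ((n+M).descFactorial n : ℝ) ≠ 0 := by
    have := Nat.descFactorial_pos.2 h
    positivity
  have := congrArg (L m) (bern n M)
  simp only [map_sum, map_smul, L_X, L_XX, smul_eq_mul] at this
  have h3 : m n = (((n+M).descFactorial n : ℝ) * m n) / ((n+M).descFactorial n : ℝ) := by
    field_simp
  rw [h3, ← this, Finset.sum_div]
  refine Finset.sum_congr rfl fun k _ => ?_
  simp only [w]; push_cast; ring

lemma close (n N k : ℕ) (hN : n < N) (hk : k ≤ N) (j : ℕ) (hj : j ≤ n) :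
    |(k.descFactorial j : ℝ) / (N.descFactorial j : ℝ) - ((k:ℝ)/N)^j| ≤ j * (n / ((N:ℝ) - n)) := by
  have hnN : (n:ℝ) < N := by exact_mod_cast hN
  have hkN : (k:ℝ) ≤ N := by exact_mod_cast hk
  have hN0 : (0:ℝ) < N := lt_of_le_of_lt (by positivity) hnN
  induction j with
  | zero => simp
  | succ j ih =>
    have ih := ih (by omega)
    have hjn : (j:ℝ) + 1 ≤ n := by exact_mod_cast hj
    set r := (k.descFactorial j : ℝ) / (N.descFactorial j : ℝ) with hr
    have hD : (0:ℝ) < (N.descFactorial j : ℝ) := by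
      exact_mod_cast Nat.descFactorial_pos.2 (by omega)
    have hr0 : 0 ≤ r := by positivity
    have hr1 : r ≤ 1 := by
      rw [hr, div_le_one hD]; exact_mod_cast Nat.descFactorial_le j hk
    have hNj : (0:ℝ) < N - j := by linarith
    have e : (k.descFactorial (j+1) : ℝ) / (N.descFactorial (j+1) : ℝ) = r * ((k - j)/(N - j)) := by
      rw [Nat.descFactorial_succ, Nat.descFactorial_succ]
      push_cast [Nat.cast_sub (by omega : j ≤ N)]
      by_cases hkj : j ≤ k
      · push_cast [Nat.cast_sub hkj]
        rw [hr]; field_simp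
      · rw [hr, Nat.descFactorial_of_lt (by omega : k < j)]; simp
    have hy0 : 0 ≤ (k:ℝ)/N := by positivity
    have hy1 : (k:ℝ)/N ≤ 1 := by rw [div_le_one hN0]; exact hkN
    have hb : |((k:ℝ) - j)/(N - j) - k/N| ≤ n / ((N:ℝ) - n) := by
      have : ((k:ℝ) - j)/(N - j) - k/N = - ((1 - k/N) * (j / (N - j))) := by
        field_simp; ring
      rw [this, abs_neg, abs_of_nonneg (mul_nonneg (by linarith) (by positivity))]
      calc _ ≤ 1 * ((j:ℝ) / (N - j)) := by gcongr; linarith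
        _ ≤ _ := by
          rw [one_mul]
          apply div_le_div₀ <;> linarith [show (0:ℝ) ≤ j by positivity]
    rw [e]
    calc _ = |r * (((k:ℝ) - j)/(N - j) - k/N) + (k/N) * (r - (k/N)^j)| := by congr 1; ring
      _ ≤ r * |((k:ℝ) - j)/(N - j) - k/N| + (k/N) * |r - (k/N)^j| := by
        refine (abs_add_le _ _).trans ?_
        rw [abs_mul, abs_mul, abs_of_nonneg hr0, abs_of_nonneg hy0]
      _ ≤ 1 * (n / ((N:ℝ) - n)) + 1 * (j * (n / ((N:ℝ) - n))) := by
        gcongr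
      _ = _ := by push_cast; ring

lemma exists_prob (m : ℕ → ℝ) (h : ∀ n k : ℕ, 0 ≤ (-1 : ℝ) ^ k * (fwdDiffSeq^[k] m) n)
    (h0 : m 0 = 1) :
    ∃ μ : ProbabilityMeasure unitInterval, ∀ n, ∫ x, (x:ℝ)^n ∂(μ : Measure unitInterval) = m n := by
  have hw : ∀ N k, 0 ≤ w m N k := fun N k => mul_nonneg (by positivity) (h _ _)
  have hw1 : ∀ N, ∑ k ∈ Finset.range (N+1), w m N k = 1 := by
    intro N
    have := sum_w m 0 N (Nat.zero_le _)
    simpa [h0] using this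
  let pt : ℕ → ℕ → unitInterval := fun N k => Set.projIcc 0 1 zero_le_one ((k:ℝ)/N)
  let ν : ℕ → Measure unitInterval := fun N =>
    ∑ k ∈ Finset.range (N+1), ENNReal.ofReal (w m N k) • Measure.dirac (pt N k)
  have hν : ∀ N, IsProbabilityMeasure (ν N) := by
    intro N
    constructor
    simp only [ν, Measure.coe_finsetSum, Finset.sum_apply, Measure.smul_apply, measure_univ,
      smul_eq_mul, mul_one]
    rw [← ENNReal.ofReal_sum_of_nonneg (fun k _ => hw N k), hw1]; simp
  have hmom : ∀ N n, ∫ x, (x:ℝ)^n ∂(ν N) =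
      ∑ k ∈ Finset.range (N+1), w m N k * ((pt N k : ℝ))^n := by
    intro N n
    simp only [ν]
    rw [integral_finsetSum_measure]
    · refine Finset.sum_congr rfl fun k _ => ?_
      rw [integral_smul_measure, integral_dirac, ENNReal.toReal_ofReal (hw N k), smul_eq_mul]
    · intro k _
      exact (integrable_dirac (by simp)).smul_measure ENNReal.ofReal_ne_top
  have hlim : ∀ n, Filter.Tendsto (fun N => ∫ x, (x:ℝ)^n ∂(ν N)) Filter.atTop (nhds (m n)) := by
    intro n
    rw [tendsto_iff_dist_tendsto_zero]
    have hb : Filter.Tendsto (fun N : ℕ => (n:ℝ) * (n / ((N:ℝ) - n))) Filter.atTop (nhds 0) := by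
      have : Filter.Tendsto (fun N : ℕ => (N:ℝ) - n) Filter.atTop Filter.atTop :=
        Filter.tendsto_atTop_add_const_right _ _ tendsto_natCast_atTop_atTop
      simpa using (this.const_div_atTop (n:ℝ)).const_mul (n:ℝ)
    refine squeeze_zero' (Filter.Eventually.of_forall fun _ => dist_nonneg) ?_ hb
    filter_upwards [Filter.eventually_gt_atTop n] with N hN
    rw [hmom, Real.dist_eq, ← sum_w m n N hN.le, ← Finset.sum_sub_distrib]
    calc _ ≤ ∑ k ∈ Finset.range (N+1), w m N k * ((n:ℝ) * (n / ((N:ℝ) - n))) := by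
          refine (Finset.abs_sum_le_sum_abs _ _).trans (Finset.sum_le_sum fun k hk => ?_)
          have hk : k ≤ N := by simpa [Nat.lt_succ_iff] using hk
          have hp : (pt N k : ℝ) = (k:ℝ)/N := by
            simp only [pt]
            rw [Set.projIcc_of_mem zero_le_one ⟨by positivity, ?_⟩]
            exact div_le_one_of_le₀ (by exact_mod_cast hk) (by positivity)
          rw [← mul_sub, abs_mul, abs_of_nonneg (hw N k), hp, abs_sub_comm]
          exact mul_le_mul_of_nonneg_left (close n N k hN hk n le_rfl) (hw N k)
      _ = _ := by rw [← Finset.sum_mul, hw1, one_mul]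
  let P : ℕ → ProbabilityMeasure unitInterval := fun N => ⟨ν N, hν N⟩
  let U : Ultrafilter (ProbabilityMeasure unitInterval) := (Filter.hyperfilter ℕ).map P
  obtain ⟨μ, -, hμ⟩ := isCompact_univ.ultrafilter_le_nhds U (by simp)
  refine ⟨μ, fun n => ?_⟩
  have hP : Filter.Tendsto P (Filter.hyperfilter ℕ) (nhds μ) := hμ
  have h1 := (ProbabilityMeasure.tendsto_iff_forall_integral_tendsto.1 hP)
    (BoundedContinuousFunction.mkOfCompact ⟨fun x : unitInterval => (x:ℝ)^n, by fun_prop⟩)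
  exact tendsto_nhds_unique h1 ((hlim n).mono_left (Nat.hyperfilter_le_atTop))

lemma exists_meas (m : ℕ → ℝ) (h : ∀ n k : ℕ, 0 ≤ (-1 : ℝ) ^ k * (fwdDiffSeq^[k] m) n) :
    ∃ μ : Measure ℝ, IsFiniteMeasure μ ∧ μ (Set.Icc (0:ℝ) 1)ᶜ = 0 ∧
        ∀ n : ℕ, m n = ∫ x in Set.Icc (0:ℝ) 1, x ^ n ∂μ := by
  have hn : ∀ n, 0 ≤ m n := fun n => by simpa using h n 0
  have hd : ∀ n, m (n+1) ≤ m n := fun n => by simpa [fwdDiffSeq] using h n 1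
  rcases (hn 0).eq_or_lt with h0 | h0
  · refine ⟨0, inferInstance, by simp, fun n => ?_⟩
    have : m n ≤ m 0 := antitone_nat_of_succ_le hd (Nat.zero_le n)
    simp; linarith [hn n]
  · have hs : ∀ k n, (fwdDiffSeq^[k] (fun i => m i / m 0)) n = (fwdDiffSeq^[k] m) n / m 0 := by
      intro k
      induction k with
      | zero => intro n; rfl
      | succ k ih => intro n; rw [step, step, ih, ih]; ring
    obtain ⟨μ, hμ⟩ := exists_prob (fun i => m i / m 0)
      (fun n k => by rw [hs, ← mul_div_assoc]; exact div_nonneg (h n k) h0.le) (div_self h0.ne')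
    have hz : (Measure.map Subtype.val (μ : Measure unitInterval)) (Set.Icc (0:ℝ) 1)ᶜ = 0 := by
      rw [Measure.map_apply measurable_subtype_coe measurableSet_Icc.compl]
      convert measure_empty (μ := (μ : Measure unitInterval))
      ext x; simpa using x.2
    refine ⟨ENNReal.ofReal (m 0) • Measure.map Subtype.val (μ : Measure unitInterval), ?_, ?_, ?_⟩
    · exact Measure.smul_finite _ ENNReal.ofReal_ne_top
    · simp [hz]
    · intro n
      rw [Measure.restrict_smul, integral_smul_measure, Measure.restrict_eq_self_of_ae_mem,
        integral_map measurable_subtype_coe.aemeasurable (by fun_prop), hμ,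
        ENNReal.toReal_ofReal h0.le, smul_eq_mul]
      · field_simp
      · exact mem_ae_iff.2 hz

lemma integrable_cont (μ : Measure ℝ) [IsFiniteMeasure μ] (f : ℝ → ℝ) (hf : Continuous f) :
    IntegrableOn f (Set.Icc 0 1) μ :=
  hf.continuousOn.integrableOn_compact isCompact_Icc

lemma integral_poly (μ ν : Measure ℝ) [IsFiniteMeasure μ] [IsFiniteMeasure ν]
    (h : ∀ n : ℕ, ∫ x in Set.Icc (0:ℝ) 1, x ^ n ∂μ = ∫ x in Set.Icc (0:ℝ) 1, x ^ n ∂ν) (p : ℝ[X]) :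
    ∫ x in Set.Icc (0:ℝ) 1, p.eval x ∂μ = ∫ x in Set.Icc (0:ℝ) 1, p.eval x ∂ν := by
  induction p using Polynomial.induction_on' with
  | add p q hp hq =>
    simp only [eval_add]
    rw [integral_add (integrable_cont _ _ p.continuous) (integrable_cont _ _ q.continuous),
      integral_add (integrable_cont _ _ p.continuous) (integrable_cont _ _ q.continuous), hp, hq]
  | monomial n a =>
    simp only [eval_monomial, integral_const_mul, h]

lemma approx (μ : Measure ℝ) [IsFiniteMeasure μ] (f : ℝ → ℝ) (hf : Continuous f) (p : ℝ[X])
    (ε : ℝ) (hp : ∀ x ∈ Set.Icc (0:ℝ) 1, |p.eval x - f x| < ε) :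
    |∫ x in Set.Icc (0:ℝ) 1, p.eval x ∂μ - ∫ x in Set.Icc (0:ℝ) 1, f x ∂μ|
      ≤ ε * μ.real (Set.Icc 0 1) := by
  rw [← integral_sub (integrable_cont _ _ p.continuous) (integrable_cont _ _ hf)]
  rw [← Real.norm_eq_abs]
  refine norm_setIntegral_le_of_norm_le_const (measure_lt_top _ _) (fun x hx => ?_)
  exact (hp x hx).le

lemma unique (μ ν : Measure ℝ) [IsFiniteMeasure μ] [IsFiniteMeasure ν]
    (hμ : μ (Set.Icc (0:ℝ) 1)ᶜ = 0) (hν : ν (Set.Icc (0:ℝ) 1)ᶜ = 0)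
    (h : ∀ n : ℕ, ∫ x in Set.Icc (0:ℝ) 1, x ^ n ∂μ = ∫ x in Set.Icc (0:ℝ) 1, x ^ n ∂ν) : μ = ν := by
  apply ext_of_forall_integral_eq_of_IsFiniteMeasure
  intro f
  have rμ : μ.restrict (Set.Icc (0:ℝ) 1) = μ :=
    Measure.restrict_eq_self_of_ae_mem (mem_ae_iff.2 hμ)
  have rν : ν.restrict (Set.Icc (0:ℝ) 1) = ν :=
    Measure.restrict_eq_self_of_ae_mem (mem_ae_iff.2 hν)
  suffices hs : ∫ x in Set.Icc (0:ℝ) 1, f x ∂μ = ∫ x in Set.Icc (0:ℝ) 1, f x ∂ν by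
    rwa [rμ, rν] at hs
  set A := μ.real (Set.Icc 0 1)
  set B := ν.real (Set.Icc 0 1)
  have hA : 0 ≤ A := measureReal_nonneg
  have hB : 0 ≤ B := measureReal_nonneg
  apply eq_of_abs_sub_le_all
  intro ε hε
  obtain ⟨p, hp⟩ := exists_polynomial_near_of_continuousOn 0 1 f f.continuous.continuousOn
    (ε / (A + B + 1)) (by positivity)
  have h1 := approx μ f f.continuous p _ hp
  have h2 := approx ν f f.continuous p _ hp
  rw [integral_poly μ ν h p] at h1
  have h3 : ε / (A + B + 1) * A + ε / (A + B + 1) * B ≤ ε := by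
    rw [← mul_add, div_mul_eq_mul_div, div_le_iff₀ (by positivity)]
    nlinarith
  rw [abs_le] at *
  constructor <;> linarith [h1.1, h1.2, h2.1, h2.2]

lemma backward (m : ℕ → ℝ) (μ : Measure ℝ) [IsFiniteMeasure μ]
    (h : ∀ n : ℕ, m n = ∫ x in Set.Icc (0:ℝ) 1, x ^ n ∂μ) (k n : ℕ) :
    (-1 : ℝ) ^ k * (fwdDiffSeq^[k] m) n = ∫ x in Set.Icc (0:ℝ) 1, x ^ n * (1 - x) ^ k ∂μ := by
  induction k generalizing n with
  | zero => simp [h]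
  | succ k ih =>
    have : ∀ x : ℝ, x ^ n * (1 - x) ^ (k+1) = x ^ n * (1 - x) ^ k - x ^ (n+1) * (1 - x) ^ k := by
      intro x; ring
    simp only [this]
    rw [integral_sub (integrable_cont _ _ (by fun_prop)) (integrable_cont _ _ (by fun_prop)),
      ← ih, ← ih, step]
    ring

end HausdorffAux

/-- Hausdorff moment problem: a real sequence is completely monotonic iff it is
the moment sequence of a (unique) finite Borel measure on `[0,1]`. -/
theorem hausdorff_moment_problem (m : ℕ → ℝ) :
    (∀ n k : ℕ, 0 ≤ (-1 : ℝ) ^ k * (fwdDiffSeq^[k] m) n) ↔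
      ∃! μ : Measure ℝ, IsFiniteMeasure μ ∧ μ (Set.Icc (0:ℝ) 1)ᶜ = 0 ∧
        ∀ n : ℕ, m n = ∫ x in Set.Icc (0:ℝ) 1, x ^ n ∂μ := by
  constructor
  · intro h
    obtain ⟨μ, hf, hz, hm⟩ := HausdorffAux.exists_meas m h
    refine ⟨μ, ⟨hf, hz, hm⟩, ?_⟩
    rintro ν ⟨hf2, hz2, hm2⟩
    exact HausdorffAux.unique ν μ hz2 hz (fun n => by rw [← hm, ← hm2])
  · rintro ⟨μ, ⟨hf, hz, hm⟩, -⟩ n k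
    rw [HausdorffAux.backward m μ hm]
    refine setIntegral_nonneg measurableSet_Icc fun x hx => ?_
    exact mul_nonneg (pow_nonneg hx.1 _) (pow_nonneg (by linarith [hx.2]) _)
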